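/- Let K(x) = sin(x)/(πx) be the sinc kernel with Fourier transform 1 on [-1,1] and 0 outside, and for a density φ_G(x) = ∫φ(x-u)dG(u) (φ standard normal) define the bias b(x) = ∫ a K(a(x-u)) φ_G(u) du - φ_G(x) for bandwidth parameter a > 0. Then sup_x |d^m b(x)/dx^m| ≤ (1/π) ∫_a^∞ u^m e^{-u²/2} du for every nonnegative integer m. -/

import Mathlib

open MeasureTheory Real

noncomputable def gaussPDF (x : ℝ) : ℝ := (Real.sqrt (2 * Real.pi))⁻¹ * Real.exp (-x ^ 2 / 2)

noncomputable def mixDensity (G : Measure ℝ) (x : ℝ) : ℝ := ∫ u, gaussPDF (x - u) ∂G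

/-- Sinc kernel `K(x) = sin x / (π x)`. -/
noncomputable def sincK (x : ℝ) : ℝ := Real.sin x / (Real.pi * x)

lemma integrable_pow_mul_exp_neg_sq_div_two (m : ℕ) :
    Integrable fun t : ℝ => t ^ m * Real.exp (-t ^ 2 / 2) := by
  have h := integrable_rpow_mul_exp_neg_mul_sq (b := 1 / 2) (by norm_num) (s := m)
    (by have : (0 : ℝ) ≤ m := Nat.cast_nonneg m
        linarith)
  refine h.congr (.of_forall fun t => ?_)
  simp only [Real.rpow_natCast]
  ring_nf

lemma integrable_exp_neg_sq_div_two : Integrable fun t : ℝ => Real.exp (-t ^ 2 / 2) := by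
  simpa using integrable_pow_mul_exp_neg_sq_div_two 0

lemma integrable_cos_mul_exp_neg_sq_div_two (c y : ℝ) :
    Integrable fun t : ℝ => Real.cos (c + t * y) * Real.exp (-t ^ 2 / 2) :=
  integrable_exp_neg_sq_div_two.bdd_mul (c := 1)
    (by fun_prop) (.of_forall fun t => Real.abs_cos_le_one _)

lemma integral_cos_mul_exp_neg_sq_div_two (c y : ℝ) :
    ∫ t : ℝ, Real.cos (c + t * y) * Real.exp (-t ^ 2 / 2) =
      √(2 * π) * (Real.cos c * Real.exp (-y ^ 2 / 2)) := by
  have h := fourierIntegral_gaussian (b := (1 / 2 : ℂ)) (by norm_num) (y : ℂ)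
  have hs : ((π : ℂ) / (1 / 2)) ^ (1 / 2 : ℂ) = ((√(2 * π) : ℝ) : ℂ) := by
    rw [Real.sqrt_eq_rpow, Complex.ofReal_cpow (by positivity)]
    push_cast
    congr 1
    ring
  have he : Complex.exp (-(y : ℂ) ^ 2 / (4 * (1 / 2))) = (Real.exp (-y ^ 2 / 2) : ℝ) := by
    push_cast
    congr 1
    ring
  rw [hs, he] at h
  have h2 := congrArg (fun z => (Complex.exp (c * Complex.I) * z).re) h
  simp only [← integral_const_mul] at h2
  have hfun : ∀ t : ℝ, Complex.exp (c * Complex.I) *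
      (Complex.exp (Complex.I * y * t) * Complex.exp (-(1 / 2) * (t : ℂ) ^ 2)) =
      Complex.exp ((c + t * y : ℝ) * Complex.I) * (Real.exp (-t ^ 2 / 2) : ℝ) := by
    intro t
    push_cast
    rw [← Complex.exp_add, ← Complex.exp_add, ← Complex.exp_add]
    congr 1
    ring
  simp only [hfun] at h2
  have hint : Integrable fun t : ℝ =>
      Complex.exp ((c + t * y : ℝ) * Complex.I) * (Real.exp (-t ^ 2 / 2) : ℝ) :=
    integrable_exp_neg_sq_div_two.ofReal.bdd_mul (c := 1) (by fun_prop)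
      (.of_forall fun t => (Complex.norm_exp_ofReal_mul_I _).le)
  have h3 := integral_re hint
  simp only [RCLike.re_to_complex, Complex.re_mul_ofReal, Complex.exp_ofReal_mul_I_re] at h3
  rw [h3, h2, ← Complex.ofReal_mul, Complex.re_mul_ofReal, Complex.exp_ofReal_mul_I_re]
  ring

lemma gaussPDF_eq_integral_cos (y : ℝ) :
    gaussPDF y = π⁻¹ * ∫ t in Set.Ioi 0, Real.cos (t * y) * Real.exp (-t ^ 2 / 2) := by
  have h := integral_comp_abs (f := fun t => Real.cos (t * y) * Real.exp (-t ^ 2 / 2))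
  have h' : ∀ t : ℝ, Real.cos (|t| * y) * Real.exp (-|t| ^ 2 / 2) =
      Real.cos (0 + t * y) * Real.exp (-t ^ 2 / 2) := by
    intro t
    rw [sq_abs, zero_add]
    rcases abs_choice t with ht | ht <;> simp [ht]
  simp only [h', integral_cos_mul_exp_neg_sq_div_two, Real.cos_zero, one_mul] at h
  have h2 : ∫ t in Set.Ioi 0, Real.cos (t * y) * Real.exp (-t ^ 2 / 2) =
      √(2 * π) / 2 * Real.exp (-y ^ 2 / 2) := by linarith
  rw [h2, gaussPDF]
  have hs : √(2 * π) * √(2 * π) = 2 * π := Real.mul_self_sqrt (by positivity)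
  have : √(2 * π) ≠ 0 := by positivity
  field_simp
  nlinarith [hs]

lemma continuous_gaussPDF : Continuous gaussPDF := by
  unfold gaussPDF
  fun_prop

lemma integrable_gaussPDF : Integrable gaussPDF :=
  integrable_exp_neg_sq_div_two.const_mul _

lemma gaussPDF_nonneg (x : ℝ) : 0 ≤ gaussPDF x := by
  unfold gaussPDF
  positivity

lemma norm_gaussPDF_le (x : ℝ) : ‖gaussPDF x‖ ≤ (√(2 * π))⁻¹ := by
  rw [Real.norm_of_nonneg (gaussPDF_nonneg x), gaussPDF]
  refine mul_le_of_le_one_right (by positivity) (Real.exp_le_one_iff.2 ?_)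
  nlinarith [sq_nonneg x]

lemma measurable_sincK : Measurable sincK := by
  unfold sincK
  fun_prop

lemma norm_sincK_le (x : ℝ) : ‖sincK x‖ ≤ π⁻¹ := by
  rw [sincK, norm_div, norm_mul, Real.norm_of_nonneg pi_pos.le, Real.norm_eq_abs, Real.norm_eq_abs]
  rcases eq_or_ne x 0 with rfl | hx
  · simp [pi_pos.le]
  · rw [div_le_iff₀ (by positivity), inv_mul_cancel_left₀ pi_ne_zero]
    exact Real.abs_sin_le_abs

lemma mul_sincK_eq_integral_cos {a y : ℝ} (ha : 0 < a) (hy : y ≠ 0) :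
    a * sincK (a * y) = π⁻¹ * ∫ t in Set.Ioc 0 a, Real.cos (t * y) := by
  rw [← intervalIntegral.integral_of_le ha.le,
    intervalIntegral.integral_comp_mul_right (fun t => Real.cos t) hy]
  simp only [integral_cos, zero_mul, Real.sin_zero, sub_zero, smul_eq_mul, sincK]
  field_simp

lemma integral_cos_mul_gaussPDF (t x v : ℝ) :
    ∫ u, Real.cos (t * (x - u)) * gaussPDF (u - v) =
      Real.cos (t * (x - v)) * Real.exp (-t ^ 2 / 2) := by
  rw [← integral_add_right_eq_self _ v]
  have h : ∀ w : ℝ, Real.cos (t * (x - (w + v))) * gaussPDF (w + v - v) =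
      (√(2 * π))⁻¹ * (Real.cos (t * (x - v) + w * (-t)) * Real.exp (-w ^ 2 / 2)) := by
    intro w
    rw [add_sub_cancel_right, gaussPDF]
    ring_nf
  simp only [h]
  rw [integral_const_mul, integral_cos_mul_exp_neg_sq_div_two]
  have : √(2 * π) ≠ 0 := by positivity
  rw [neg_sq]
  field_simp

/-- Convolving a Gaussian with the rescaled sinc kernel truncates its Fourier representation. -/
lemma integral_sincK_mul_gaussPDF {a : ℝ} (ha : 0 < a) (x v : ℝ) :
    ∫ u, a * sincK (a * (x - u)) * gaussPDF (u - v) =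
      π⁻¹ * ∫ t in Set.Ioc 0 a, Real.cos (t * (x - v)) * Real.exp (-t ^ 2 / 2) := by
  have hae : (fun u => a * sincK (a * (x - u)) * gaussPDF (u - v)) =ᵐ[volume]
      fun u => π⁻¹ * ∫ t in Set.Ioc 0 a, Real.cos (t * (x - u)) * gaussPDF (u - v) := by
    filter_upwards [Measure.ae_ne volume x] with u hu
    rw [mul_sincK_eq_integral_cos ha (sub_ne_zero.2 hu.symm), integral_mul_const, mul_assoc]
  rw [integral_congr_ae hae, integral_const_mul, integral_integral_swap]
  · simp only [integral_cos_mul_gaussPDF]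
  · have h : Integrable (fun p : ℝ × ℝ => gaussPDF (p.1 - v))
        (volume.prod (volume.restrict (Set.Ioc 0 a))) :=
      (integrable_gaussPDF.comp_sub_right v).comp_fst _
    exact h.bdd_mul (c := 1) (by fun_prop) (.of_forall fun p => Real.abs_cos_le_one _)

lemma integrable_sincK_mul_gaussPDF (G : Measure ℝ) [IsProbabilityMeasure G] (a x : ℝ) :
    Integrable (fun p : ℝ × ℝ => a * sincK (a * (x - p.1)) * gaussPDF (p.1 - p.2))
      (volume.prod G) := by
  have hg : Integrable (fun p : ℝ × ℝ => gaussPDF (p.1 - p.2)) (volume.prod G) := by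
    have hc : Continuous (fun p : ℝ × ℝ => gaussPDF (p.1 - p.2)) :=
      continuous_gaussPDF.comp (by fun_prop)
    rw [integrable_prod_iff' hc.aestronglyMeasurable]
    refine ⟨.of_forall fun v => integrable_gaussPDF.comp_sub_right v, ?_⟩
    have h : ∀ v, ∫ u, ‖gaussPDF (u - v)‖ = ∫ u, ‖gaussPDF u‖ := fun v =>
      integral_sub_right_eq_self (fun u => ‖gaussPDF u‖) v
    simp only [h]
    exact integrable_const _
  refine hg.bdd_mul (c := |a| * π⁻¹)
    ((measurable_sincK.comp (by fun_prop)).const_mul a).aestronglyMeasurable (.of_forall fun p => ?_)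
  rw [norm_mul, Real.norm_eq_abs a]
  gcongr
  exact norm_sincK_le _

/-- The `m`-th derivative of minus `π` times the bias, written as a Fourier tail integral. -/
noncomputable def tailIntegral (G : Measure ℝ) (a : ℝ) (m : ℕ) (x : ℝ) : ℝ :=
  ∫ p : ℝ × ℝ, Real.cos (p.1 * (x - p.2) + m * (π / 2)) * (p.1 ^ m * Real.exp (-p.1 ^ 2 / 2))
    ∂((volume.restrict (Set.Ioi a)).prod G)

section

variable (G : Measure ℝ) [IsProbabilityMeasure G] (a : ℝ) (m : ℕ)

lemma integrable_pow_mul_exp_prod :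
    Integrable (fun p : ℝ × ℝ => p.1 ^ m * Real.exp (-p.1 ^ 2 / 2))
      ((volume.restrict (Set.Ioi a)).prod G) :=
  (integrable_pow_mul_exp_neg_sq_div_two m).restrict.comp_fst G

lemma integrable_tailIntegral (x : ℝ) :
    Integrable (fun p : ℝ × ℝ => Real.cos (p.1 * (x - p.2) + m * (π / 2)) *
      (p.1 ^ m * Real.exp (-p.1 ^ 2 / 2))) ((volume.restrict (Set.Ioi a)).prod G) :=
  (integrable_pow_mul_exp_prod G a m).bdd_mul (c := 1) (by fun_prop)
    (.of_forall fun p => Real.abs_cos_le_one _)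

lemma hasDerivAt_tailIntegral (x : ℝ) :
    HasDerivAt (tailIntegral G a m) (tailIntegral G a (m + 1) x) x := by
  refine (hasDerivAt_integral_of_dominated_loc_of_deriv_le
    (μ := (volume.restrict (Set.Ioi a)).prod G) (x₀ := x)
    (F := fun (y : ℝ) (p : ℝ × ℝ) => Real.cos (p.1 * (y - p.2) + m * (π / 2)) *
      (p.1 ^ m * Real.exp (-p.1 ^ 2 / 2)))
    (F' := fun (y : ℝ) (p : ℝ × ℝ) => Real.cos (p.1 * (y - p.2) + (m + 1 : ℕ) * (π / 2)) *
      (p.1 ^ (m + 1) * Real.exp (-p.1 ^ 2 / 2)))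
    (bound := fun p => ‖p.1 ^ (m + 1) * Real.exp (-p.1 ^ 2 / 2)‖) Filter.univ_mem
    (.of_forall fun y => by fun_prop)
    (integrable_tailIntegral G a m x)
    (by fun_prop)
    (.of_forall fun p y _ => ?_) (integrable_pow_mul_exp_prod G a (m + 1)).norm
    (.of_forall fun p y _ => ?_)).2
  · rw [norm_mul]
    exact mul_le_of_le_one_left (norm_nonneg _) (Real.abs_cos_le_one _)
  · have h : HasDerivAt (fun y => p.1 * (y - p.2) + m * (π / 2)) (p.1 * 1) y :=
      (((hasDerivAt_id y).sub_const _).const_mul _).add_const _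
    refine (h.cos.mul_const (p.1 ^ m * Real.exp (-p.1 ^ 2 / 2))).congr_deriv ?_
    rw [Nat.cast_succ, add_one_mul, ← add_assoc, Real.cos_add_pi_div_two]
    ring

lemma iteratedDeriv_tailIntegral : iteratedDeriv m (tailIntegral G a 0) = tailIntegral G a m := by
  induction m with
  | zero => exact iteratedDeriv_zero
  | succ k ih =>
    rw [iteratedDeriv_succ, ih]
    exact funext fun x => (hasDerivAt_tailIntegral G a k x).deriv

variable {a}

lemma abs_tailIntegral_le (ha : 0 < a) (x : ℝ) :
    |tailIntegral G a m x| ≤ ∫ u in Set.Ioi a, u ^ m * Real.exp (-u ^ 2 / 2) := by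
  have h : ∫ p : ℝ × ℝ, ‖p.1 ^ m * Real.exp (-p.1 ^ 2 / 2)‖ ∂((volume.restrict (Set.Ioi a)).prod G)
      = ∫ u in Set.Ioi a, u ^ m * Real.exp (-u ^ 2 / 2) := by
    rw [integral_fun_fst (fun u : ℝ => ‖u ^ m * Real.exp (-u ^ 2 / 2)‖), probReal_univ, one_smul]
    refine setIntegral_congr_fun measurableSet_Ioi fun u hu => ?_
    have hu' : 0 < u := ha.trans hu
    exact Real.norm_of_nonneg (by positivity)
  rw [← h, ← Real.norm_eq_abs]
  refine norm_integral_le_of_norm_le (integrable_pow_mul_exp_prod G a m).norm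
    (.of_forall fun p => ?_)
  rw [norm_mul]
  exact mul_le_of_le_one_left (norm_nonneg _) (Real.abs_cos_le_one _)

lemma bias_eq_tailIntegral (ha : 0 < a) (x : ℝ) :
    (∫ u, a * sincK (a * (x - u)) * mixDensity G u) - mixDensity G x =
      -π⁻¹ * tailIntegral G a 0 x := by
  have hF := integrable_sincK_mul_gaussPDF G a x
  have hg : Integrable (fun v => gaussPDF (x - v)) G :=
    .of_bound (continuous_gaussPDF.comp (by fun_prop)).aestronglyMeasurable _
      (.of_forall fun v => norm_gaussPDF_le _)
  have h0 := integrable_tailIntegral G a 0 x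
  simp only [mixDensity, ← integral_const_mul]
  rw [integral_integral_swap hF, ← integral_sub hF.integral_prod_right hg, tailIntegral,
    integral_prod_symm _ h0, ← integral_const_mul]
  refine integral_congr_ae (.of_forall fun v => ?_)
  have hi := integrable_cos_mul_exp_neg_sq_div_two 0 (x - v)
  simp only [zero_add] at hi
  simp only [integral_sincK_mul_gaussPDF ha, gaussPDF_eq_integral_cos (x - v), Nat.cast_zero,
    zero_mul, add_zero, pow_zero, one_mul]
  rw [← Set.Ioc_union_Ioi_eq_Ioi ha.le, setIntegral_union Set.Ioc_disjoint_Ioi_same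
    measurableSet_Ioi hi.integrableOn hi.integrableOn]
  ring

end

theorem stmt_18 (G : Measure ℝ) [IsProbabilityMeasure G] (a : ℝ) (ha : 0 < a) (m : ℕ)
    (b : ℝ → ℝ)
    (hb : b = fun x => (∫ u, a * sincK (a * (x - u)) * mixDensity G u) - mixDensity G x) :
    ∀ x : ℝ, |iteratedDeriv m b x| ≤
      (1 / Real.pi) * ∫ u in Set.Ioi a, u ^ m * Real.exp (-u ^ 2 / 2) := by
  intro x
  have hb' : b = fun x => -π⁻¹ * tailIntegral G a 0 x := by
    rw [hb]
    exact funext fun x => bias_eq_tailIntegral G ha x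
  rw [hb', iteratedDeriv_const_mul_field, iteratedDeriv_tailIntegral, abs_mul, abs_neg,
    abs_of_pos (inv_pos.2 pi_pos), one_div]
  gcongr
  exact abs_tailIntegral_le G m ha x
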